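/- Let q = p^e be an odd prime power, m ≥ 2, N = p^e + 1, α a generator of GF(q^{2s})^* for m = 2s, and θ = α^N. The cyclic code C = {(Tr_{q^m/q}(a θ^t))_{t=0}^{(q^m−1)/N − 1} : a ∈ GF(q^m)} has length (q^m − 1)/N, and the number of coordinates t with Tr_{q^m/q}(a θ^t) = 0, for a ≠ 0, takes only the values (q^{m−1} − 1 ± (q−1)(N−1)q^{(m−2)/2})/N or (q^{m−1} − 1 ∓ (q−1)q^{(m−2)/2})/N depending on the parity of s and the class of a. -/

import Mathlib

open Finset

section
variable {F K : Type*} [Field F] [Field K] [Fintype F] [Fintype K] [Algebra F K]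

theorem exists_pow_card_add_one_eq_algebraMap {s : ℕ}
    (hK : Fintype.card K = Fintype.card F ^ (2 * s)) {c : F} (hc : c ≠ 0) :
    ∃ u : K, u ≠ 0 ∧ u ^ (Fintype.card F + 1) = algebraMap F K c := by
  classical
  obtain ⟨α, hα⟩ := IsCyclic.exists_generator (α := Kˣ)
  set q := Fintype.card F with hq
  have hq1 : 1 < q := Fintype.one_lt_card
  have hc' : algebraMap F K c ≠ 0 := by simpa using hc
  obtain ⟨k, hk⟩ := mem_powers_iff_mem_zpowers.mpr (hα (Units.mk0 _ hc'))
  have hord : orderOf α = q ^ (2 * s) - 1 := by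
    rw [orderOf_eq_card_of_forall_mem_zpowers hα, Nat.card_eq_fintype_card, Fintype.card_units, hK]
  have hpow : α ^ (k * (q - 1)) = 1 := by
    rw [pow_mul]
    simp only at hk
    rw [hk]
    ext
    simp [← map_pow, hq, FiniteField.pow_card_sub_one_eq_one c hc]
  have hdvd : (q + 1) * (q - 1) ∣ k * (q - 1) := by
    have h1 : (q + 1) * (q - 1) ∣ q ^ (2 * s) - 1 := by
      have := Nat.sub_dvd_pow_sub_pow (q ^ 2) 1 s
      rwa [← pow_mul, one_pow, show q ^ 2 - 1 = (q + 1) * (q - 1) from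
        by simpa using Nat.sq_sub_sq q 1] at this
    exact h1.trans (hord ▸ orderOf_dvd_of_pow_eq_one hpow)
  obtain ⟨j, rfl⟩ := Nat.dvd_of_mul_dvd_mul_right (by omega) hdvd
  refine ⟨((α ^ j : Kˣ) : K), Units.ne_zero _, ?_⟩
  have := congrArg Units.val hk
  simp only [Units.val_mk0] at this
  rw [← this, ← Units.val_pow_eq_pow_val, ← pow_mul, mul_comm j]

theorem card_trace_mul_pow_eq {s : ℕ} [DecidableEq F]
    (hK : Fintype.card K = Fintype.card F ^ (2 * s)) (a : K) {c : F} (hc : c ≠ 0) :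
    #{x : K | Algebra.trace F K (a * x ^ (Fintype.card F + 1)) = c} =
      #{x : K | Algebra.trace F K (a * x ^ (Fintype.card F + 1)) = 1} := by
  obtain ⟨u, hu, huc⟩ := exists_pow_card_add_one_eq_algebraMap hK hc
  symm
  refine Finset.card_equiv (Equiv.mulLeft₀ u hu) fun x => ?_
  have : a * (u * x) ^ (Fintype.card F + 1) = c • (a * x ^ (Fintype.card F + 1)) := by
    rw [mul_pow, huc, Algebra.smul_def]; ring
  simp only [mem_filter, mem_univ, true_and, Equiv.mulLeft₀_apply, this, map_smul, smul_eq_mul]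
  rw [mul_eq_left₀ hc]

theorem card_trace_mul_eq_zero [DecidableEq F] {b : K} (hb : b ≠ 0) :
    Fintype.card F * #{v : K | Algebra.trace F K (b * v) = 0} = Fintype.card K := by
  classical
  let f : K →ₗ[F] F := Algebra.trace F K ∘ₗ LinearMap.mulLeft F b
  have hf : Function.Surjective f :=
    (Algebra.trace_surjective F K).comp (mul_left_surjective₀ hb)
  have h := Submodule.card_eq_card_quotient_mul_card (LinearMap.ker f)
  rw [Nat.card_congr (f.quotKerEquivOfSurjective hf).toEquiv] at h
  simp only [Nat.card_eq_fintype_card] at h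
  rw [h, mul_comm, Fintype.card_subtype]
  simp [f]

theorem card_pow_sq_eq_self {s q : ℕ} [DecidableEq K] (hq : 1 < q)
    (hK : Fintype.card K = q ^ (2 * s)) : #{c : K | c ^ q ^ 2 = c} = q ^ 2 := by
  have hq2 : 1 < q ^ 2 := Nat.one_lt_pow two_ne_zero hq
  have hcard := IsCyclic.card_powMonoidHom_ker (G := Kˣ) (q ^ 2 - 1)
  rw [Nat.card_eq_fintype_card (α := Kˣ), Fintype.card_units, hK, Nat.gcd_eq_right (by
    simpa [pow_mul] using Nat.sub_dvd_pow_sub_pow (q ^ 2) 1 s)] at hcard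
  have hz : (0 : K) ∉ (univ.filter fun c : Kˣ => c ^ (q ^ 2 - 1) = 1).map
      ⟨Units.val, Units.val_injective⟩ := by simp
  have : ({c : K | c ^ q ^ 2 = c} : Finset K) =
      cons 0 ((univ.filter fun c : Kˣ => c ^ (q ^ 2 - 1) = 1).map
        ⟨Units.val, Units.val_injective⟩) hz := by
    ext c
    rcases eq_or_ne c 0 with rfl | hc
    · simp; omega
    · lift c to Kˣ using hc.isUnit
      have h1 : c ^ q ^ 2 = c ^ (q ^ 2 - 1) * c := by rw [← pow_succ]; congr; omega
      simp [← Units.val_pow_eq_pow_val, h1]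
  rw [this, card_cons, card_map, ← Fintype.card_subtype, ← Nat.card_eq_fintype_card]
  have h2 : Nat.card {c : Kˣ // c ^ (q ^ 2 - 1) = 1} = q ^ 2 - 1 := hcard
  omega

variable (F) in
/-- The map `L` with `Tr (a * (x ^ q * y + x * y ^ q)) = Tr (L x * y)`. -/
noncomputable def polarMap (a : K) (u : K) : K :=
  a * u ^ Fintype.card F + (FiniteField.frobeniusAlgEquivOfAlgebraic F K).symm (a * u)

theorem trace_polarMap_mul (a u v : K) :
    Algebra.trace F K (polarMap F a u * v) =
      Algebra.trace F K (a * (u ^ Fintype.card F * v + u * v ^ Fintype.card F)) := by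
  set φ := FiniteField.frobeniusAlgEquivOfAlgebraic F K
  have hφ : ∀ x, φ x = x ^ Fintype.card F := fun x => rfl
  have h : Algebra.trace F K (φ.symm (a * u) * v) =
      Algebra.trace F K (a * u * v ^ Fintype.card F) := by
    rw [← Algebra.trace_eq_of_algEquiv φ, map_mul, AlgEquiv.apply_symm_apply, hφ]
  rw [polarMap, add_mul, map_add, h, ← map_add]
  congr 1
  ring

theorem polarMap_eq_zero_iff (a u : K) :
    polarMap F a u = 0 ↔ a ^ Fintype.card F * u ^ Fintype.card F ^ 2 + a * u = 0 := by
  set φ := FiniteField.frobeniusAlgEquivOfAlgebraic F K with hφd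
  have hφ : ∀ x, φ x = x ^ Fintype.card F := fun x => rfl
  rw [← map_eq_zero_iff φ φ.injective, polarMap, map_add, ← hφd, AlgEquiv.apply_symm_apply, hφ,
    mul_pow, ← pow_mul, ← sq]

theorem card_polarMap_eq_zero {s : ℕ} [DecidableEq K]
    (hK : Fintype.card K = Fintype.card F ^ (2 * s)) {a : K} (ha : a ≠ 0) :
    #{u : K | polarMap F a u = 0} = 1 ∨
      #{u : K | polarMap F a u = 0} = Fintype.card F ^ 2 := by
  have hq : 1 < Fintype.card F := Fintype.one_lt_card
  simp_rw [polarMap_eq_zero_iff]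
  set q := Fintype.card F
  by_cases h : ∃ u₀ : K, u₀ ≠ 0 ∧ a ^ q * u₀ ^ q ^ 2 + a * u₀ = 0
  · right
    obtain ⟨u₀, hu₀, h₀⟩ := h
    refine Eq.trans (Eq.symm ?_) (card_pow_sq_eq_self hq hK)
    refine Finset.card_equiv (Equiv.mulLeft₀ u₀ hu₀) fun c => ?_
    have : a ^ q * (u₀ * c) ^ q ^ 2 + a * (u₀ * c) = - (a * u₀) * (c ^ q ^ 2 - c) := by
      rw [mul_pow]; linear_combination c ^ q ^ 2 * h₀
    simp only [mem_filter, mem_univ, true_and, Equiv.mulLeft₀_apply, this]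
    simp [ha, hu₀, sub_eq_zero]
  · left
    push Not at h
    rw [card_eq_one]
    refine ⟨0, ?_⟩
    ext u
    simp only [mem_filter, mem_univ, true_and, mem_singleton]
    refine ⟨fun hu => by_contra fun h0 => h u h0 hu, ?_⟩
    rintro rfl
    simp; omega

theorem sum_sq_card_fiber {ι κ : Type*} [Fintype ι] [Fintype κ] [DecidableEq κ] (f : ι → κ) :
    ∑ c, #{x | f x = c} ^ 2 = #{w : ι × ι | f w.1 = f w.2} := by
  rw [card_eq_sum_card_fiberwise (f := fun w => f w.1) (t := univ) (by simp)]
  refine sum_congr rfl fun c _ => ?_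
  rw [sq, ← card_product]
  congr 1
  ext ⟨x, y⟩
  simp only [mem_product, mem_filter, mem_univ, true_and]
  grind

theorem card_trace_mul_pow_eq_pairs [DecidableEq F] (h2 : (2 : F) ≠ 0) (a : K) :
    #{w : K × K | Algebra.trace F K (a * w.1 ^ (Fintype.card F + 1)) =
        Algebra.trace F K (a * w.2 ^ (Fintype.card F + 1))} =
      #{w : K × K | Algebra.trace F K (polarMap F a w.1 * w.2) = 0} := by
  have h2K : (2 : K) ≠ 0 := by
    rw [← map_ofNat (algebraMap F K) 2]
    exact (map_ne_zero (algebraMap F K)).mpr h2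
  let E : K × K ≃ K × K :=
    { toFun := fun w => (w.1 + w.2, w.1 - w.2)
      invFun := fun w => ((w.1 + w.2) / 2, (w.1 - w.2) / 2)
      left_inv := fun w => by ext <;> simp <;> field_simp <;> ring
      right_inv := fun w => by ext <;> simp <;> field_simp <;> ring }
  symm
  refine Finset.card_equiv E fun w => ?_
  obtain ⟨u, v⟩ := w
  simp only [mem_filter, mem_univ, true_and, E, Equiv.coe_fn_mk]
  have hadd : (u + v) ^ Fintype.card F = u ^ Fintype.card F + v ^ Fintype.card F :=
    map_add (FiniteField.frobeniusAlgHom F K) u v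
  have hsub : (u - v) ^ Fintype.card F = u ^ Fintype.card F - v ^ Fintype.card F :=
    map_sub (FiniteField.frobeniusAlgHom F K) u v
  rw [trace_polarMap_mul, ← sub_eq_zero (b := Algebra.trace F K _), ← map_sub]
  have : a * (u + v) ^ (Fintype.card F + 1) - a * (u - v) ^ (Fintype.card F + 1) =
      (2 : F) • (a * (u ^ Fintype.card F * v + u * v ^ Fintype.card F)) := by
    rw [pow_succ, pow_succ, hadd, hsub, Algebra.smul_def, map_ofNat]; ring
  rw [this, map_smul, smul_eq_mul, mul_eq_zero, or_iff_right h2]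

theorem card_polar_pairs [DecidableEq F] [DecidableEq K] (a : K) :
    (Fintype.card F : ℤ) * #{w : K × K | Algebra.trace F K (polarMap F a w.1 * w.2) = 0} =
      Fintype.card K *
        (Fintype.card K + (Fintype.card F - 1) * #{u : K | polarMap F a u = 0}) := by
  have h1 : #{w : K × K | Algebra.trace F K (polarMap F a w.1 * w.2) = 0} =
      ∑ u : K, #{v : K | Algebra.trace F K (polarMap F a u * v) = 0} := by
    simp_rw [card_filter, Fintype.sum_prod_type]
  have h2 : ∀ u : K, (Fintype.card F : ℤ) *
      #{v : K | Algebra.trace F K (polarMap F a u * v) = 0} =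
      Fintype.card K * (1 + (Fintype.card F - 1) * if polarMap F a u = 0 then 1 else 0) := by
    intro u
    split_ifs with h
    · simp [h]; ring
    · have := card_trace_mul_eq_zero (F := F) h
      rw [← Nat.cast_mul, this]; simp
  rw [h1, Nat.cast_sum, mul_sum, sum_congr rfl fun u _ => h2 u, ← mul_sum, sum_add_distrib,
    ← mul_sum]
  simp

/-- The number of zeros of `x ↦ Tr (a * x ^ (q + 1))`. -/
theorem card_trace_mul_pow_eq_zero [DecidableEq F] {s : ℕ}
    (hK : Fintype.card K = Fintype.card F ^ (2 * s)) (h2 : (2 : F) ≠ 0) {a : K} (ha : a ≠ 0) :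
    ∃ S : ℤ, (S = Fintype.card F ^ s ∨ S = - Fintype.card F ^ s ∨
        S = Fintype.card F ^ (s + 1) ∨ S = - Fintype.card F ^ (s + 1)) ∧
      (Fintype.card F : ℤ) * #{x : K | Algebra.trace F K (a * x ^ (Fintype.card F + 1)) = 0} =
        Fintype.card F ^ (2 * s) + (Fintype.card F - 1) * S := by
  classical
  let f : K → F := fun x => Algebra.trace F K (a * x ^ (Fintype.card F + 1))
  have hfib : ∀ c ∈ univ.erase (0 : F), #{x | f x = c} = #{x | f x = 1} := fun c hc =>
    card_trace_mul_pow_eq hK a (ne_of_mem_erase hc)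
  have hlin : ∑ c, #{x | f x = c} = Fintype.card K :=
    (card_eq_sum_card_fiberwise (s := univ) (by simp)).symm
  have hsq := sum_sq_card_fiber f
  have hpairs := card_polar_pairs (F := F) a
  rw [← card_trace_mul_pow_eq_pairs h2, ← hsq] at hpairs
  rw [← add_sum_erase _ _ (mem_univ 0), sum_congr rfl hfib] at hlin
  rw [← add_sum_erase _ _ (mem_univ 0), sum_congr rfl fun c hc => by rw [hfib c hc]] at hpairs
  have hq : 1 < Fintype.card F := Fintype.one_lt_card
  simp only [sum_const, card_erase_of_mem (mem_univ _), card_univ, smul_eq_mul] at hlin hpairs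
  change ∃ S : ℤ, _ ∧ (Fintype.card F : ℤ) * #{x | f x = 0} = _
  generalize #{x | f x = 0} = Z at *
  generalize #{x | f x = 1} = w at *
  have hR := card_polarMap_eq_zero hK ha
  rw [hK] at hlin hpairs
  generalize #{u : K | polarMap F a u = 0} = R at *
  generalize Fintype.card F = q at *
  zify [hq.le] at hlin
  push_cast [hq.le] at hpairs
  have hS : ((Z : ℤ) - w) ^ 2 = q ^ (2 * s) * R := by
    have : ((q : ℤ) - 1) ≠ 0 := by omega
    apply mul_left_cancel₀ this
    rw [← hlin] at hpairs ⊢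
    linear_combination hpairs
  refine ⟨(Z : ℤ) - w, ?_, by linear_combination hlin⟩
  rcases hR with rfl | rfl
  · have : ((Z : ℤ) - w) ^ 2 = (q ^ s) ^ 2 := by rw [hS]; push_cast; ring
    rcases sq_eq_sq_iff_eq_or_eq_neg.mp this with h | h <;> simp [h]
  · have : ((Z : ℤ) - w) ^ 2 = (q ^ (s + 1)) ^ 2 := by rw [hS]; push_cast; ring
    rcases sq_eq_sq_iff_eq_or_eq_neg.mp this with h | h <;> simp [h]

end

theorem card_filter_range_mul_of_periodic (P : ℕ → Prop) [DecidablePred P] (n : ℕ)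
    (hP : Function.Periodic P n) (N : ℕ) :
    #{t ∈ range (N * n) | P t} = N * #{t ∈ range n | P t} := by
  simp_rw [card_filter]
  induction N with
  | zero => simp
  | succ N ih =>
    have hPN : ∀ t, P (N * n + t) = P t := fun t => by
      have := (hP.nat_mul N) t
      rwa [add_comm] at this
    rw [add_one_mul, sum_range_add, ih, add_one_mul]
    simp only [hPN]

theorem card_filter_range_generator {K : Type*} [Field K] [Fintype K] [DecidableEq K] {α : Kˣ}
    (hα : ∀ x : Kˣ, x ∈ Subgroup.zpowers α) (P : K → Prop) [DecidablePred P] (h0 : P 0) :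
    #{t ∈ range (Fintype.card K - 1) | P ((α : K) ^ t)} + 1 = #{x : K | P x} := by
  have hord : orderOf α = Fintype.card K - 1 := by
    rw [orderOf_eq_card_of_forall_mem_zpowers hα, Nat.card_eq_fintype_card, Fintype.card_units]
  rw [← card_erase_add_one (s := univ.filter P) (a := 0) (by simpa using h0)]
  congr 1
  refine card_bij (fun t _ => (α : K) ^ t) ?_ ?_ ?_
  · intro t ht
    simp at ht
    simp [ht.2]
  · intro t ht t' ht' h
    simp only [mem_filter, mem_range, ← hord] at ht ht'
    refine pow_injOn_Iio_orderOf (x := α) ht.1 ht'.1 (Units.ext ?_)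
    simpa using h
  · intro x hx
    simp only [mem_erase, mem_filter, mem_univ, true_and] at hx
    have := hα (Units.mk0 x hx.1)
    rw [mem_zpowers_iff_mem_range_orderOf] at this
    simp only [mem_image, mem_range, hord] at this
    obtain ⟨t, ht, h⟩ := this
    have hpow : (α : K) ^ t = x := by simpa using congrArg Units.val h
    exact ⟨t, by simp [ht, hpow, hx.2], hpow⟩

/-- Irreducible cyclic code count: q = p^e odd, m = 2s, N = q + 1, θ = α^N for a generator
α of GF(q^m)^*. The code {(Tr(a θ^t))_{t<n} : a ∈ GF(q^m)} has length n = (q^m−1)/N, and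
for a ≠ 0 the number N₀ of coordinates t with Tr(a θ^t) = 0 satisfies
N·N₀ ∈ {q^{m−1}−1 ± (q−1)(N−1)q^{(m−2)/2}, q^{m−1}−1 ∓ (q−1)q^{(m−2)/2}}. -/
theorem stmt17 {p e s : ℕ} (hp : p.Prime) (hodd : Odd p) (he : 0 < e) (hs : 1 ≤ s)
    {F K : Type*} [Field F] [Field K] [Fintype F] [Fintype K] [DecidableEq F]
    [Algebra F K] [FiniteDimensional F K]
    (q N m : ℕ) (hq : q = p ^ e) (hm : m = 2 * s) (hN : N = p ^ e + 1)
    (hcardF : Fintype.card F = q) (hcardK : Fintype.card K = q ^ m)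
    (α : Kˣ) (hα : ∀ x : Kˣ, x ∈ Subgroup.zpowers α)
    (θ : K) (hθ : θ = (α : K) ^ N)
    (n : ℕ) (hn : n = (q ^ m - 1) / N)
    (a : K) (ha : a ≠ 0) :
    N * n = q ^ m - 1 ∧
    ((N : ℤ) * ((Finset.range n).filter fun t => Algebra.trace F K (a * θ ^ t) = 0).card =
        (q : ℤ) ^ (m - 1) - 1 + (q - 1) * (N - 1) * (q : ℤ) ^ (s - 1) ∨
      (N : ℤ) * ((Finset.range n).filter fun t => Algebra.trace F K (a * θ ^ t) = 0).card =
        (q : ℤ) ^ (m - 1) - 1 - (q - 1) * (N - 1) * (q : ℤ) ^ (s - 1) ∨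
      (N : ℤ) * ((Finset.range n).filter fun t => Algebra.trace F K (a * θ ^ t) = 0).card =
        (q : ℤ) ^ (m - 1) - 1 + (q - 1) * (q : ℤ) ^ (s - 1) ∨
      (N : ℤ) * ((Finset.range n).filter fun t => Algebra.trace F K (a * θ ^ t) = 0).card =
        (q : ℤ) ^ (m - 1) - 1 - (q - 1) * (q : ℤ) ^ (s - 1)) := by
  classical
  subst hm hcardF hθ
  rw [← hq] at hN
  subst hN
  have hq1 : 1 < Fintype.card F := Fintype.one_lt_card
  have hlen : (Fintype.card F + 1) * n = Fintype.card F ^ (2 * s) - 1 := by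
    rw [hn]
    refine Nat.mul_div_cancel' (Dvd.dvd.trans ⟨Fintype.card F - 1, ?_⟩
      (by simpa [pow_mul] using Nat.sub_dvd_pow_sub_pow (Fintype.card F ^ 2) 1 s))
    simpa using Nat.sq_sub_sq (Fintype.card F) 1
  have h2 : (2 : F) ≠ 0 := by
    refine Ring.two_ne_zero fun h => ?_
    have := FiniteField.even_card_iff_char_two.mp h
    exact Nat.not_even_iff_odd.mpr (hq ▸ hodd.pow) (Nat.even_iff.mpr this)
  refine ⟨hlen, ?_⟩
  have hper : Function.Periodic
      (fun t => Algebra.trace F K (a * ((α : K) ^ (Fintype.card F + 1)) ^ t) = 0) n := fun t => by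
    have h1 : ((α : K) ^ (Fintype.card F + 1)) ^ n = 1 := by
      rw [← pow_mul, hlen, ← hcardK]
      exact FiniteField.pow_card_sub_one_eq_one _ α.ne_zero
    simp only [pow_add _ t n, h1, mul_one]
  have hcount := card_filter_range_mul_of_periodic _ n hper (Fintype.card F + 1)
  have hgen := card_filter_range_generator hα
    (fun x => Algebra.trace F K (a * x ^ (Fintype.card F + 1)) = 0) (by simp)
  simp_rw [← pow_mul, mul_comm _ (Fintype.card F + 1)] at hgen
  simp_rw [← pow_mul] at hcount
  rw [hcardK, ← hlen, hcount] at hgen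
  obtain ⟨S, hS, hZ⟩ := card_trace_mul_pow_eq_zero hcardK h2 ha
  rw [← hgen] at hZ
  simp_rw [← pow_mul]
  generalize #{t ∈ range n |
    Algebra.trace F K (a * (α : K) ^ ((Fintype.card F + 1) * t)) = 0} = M at *
  generalize Fintype.card F = q at *
  have hq0 : (q : ℤ) ≠ 0 := by omega
  obtain ⟨k, rfl⟩ : ∃ k, s = k + 1 := ⟨s - 1, by omega⟩
  rw [show 2 * (k + 1) - 1 = 2 * k + 1 by omega, Nat.add_sub_cancel]
  push_cast at hZ ⊢
  rcases hS with rfl | rfl | rfl | rfl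
  · right; right; left
    apply mul_left_cancel₀ hq0
    linear_combination hZ
  · right; right; right
    apply mul_left_cancel₀ hq0
    linear_combination hZ
  · left
    apply mul_left_cancel₀ hq0
    linear_combination hZ
  · right; left
    apply mul_left_cancel₀ hq0
    linear_combination hZ
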